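/- Let N ≥ 2 and let H be an H-matrix satisfying the H-invariance conditions P(N−1,m;H) = (1/N)·C(N,m+1) for m = 1,…,N−1, and suppose λ*_{k,j}(H) = 0 for all j = 1,…,N−2 and k = j+1,…,N−1. Then Q(N−1,k,j;H) = (1/(k+1))·C(N−j−1,k−1) for all j = 1,…,N−1 and k = 1,…,N−j, and H is the H-matrix of Dual-OHM: h_{k,k} = (N−k)/(N−k+1) for k = 1,…,N−1 and h_{k,j} = −(N−k)/((N−j)(N−j+1)) for 1 ≤ j < k ≤ N−1. -/

import Mathlib

open Finset

/-- `Pinv H k m` is `P(k,m;H)`: the sum over all index sequences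
`1 ≤ j(1) ≤ i(1) < j(2) ≤ i(2) < ⋯ < j(m) ≤ i(m) ≤ k` of `∏_{r} h_{i(r),j(r)}`,
with `P(k,0;H) = 1`. -/
noncomputable def Pinv (H : ℕ → ℕ → ℝ) (k : ℕ) : ℕ → ℝ
  | 0 => 1
  | m + 1 =>
    ∑ f : Fin (m + 1) → Fin (k + 1) × Fin (k + 1),
      if (∀ r, 1 ≤ ((f r).2 : ℕ) ∧ ((f r).2 : ℕ) ≤ ((f r).1 : ℕ)) ∧
          (∀ r : Fin m, ((f r.castSucc).1 : ℕ) < ((f r.succ).2 : ℕ)) then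
        ∏ r, H ((f r).1 : ℕ) ((f r).2 : ℕ)
      else 0

/-- `Qinv H k m j` is `Q(k,m,j;H)`: the partial sum of `P(k,m;H)` over those index
sequences with `j(1) = j` (zero if no such sequence exists, and zero for `m = 0`). -/
noncomputable def Qinv (H : ℕ → ℕ → ℝ) (k : ℕ) : ℕ → ℕ → ℝ
  | 0, _ => 0
  | m + 1, j =>
    ∑ f : Fin (m + 1) → Fin (k + 1) × Fin (k + 1),
      if (∀ r, 1 ≤ ((f r).2 : ℕ) ∧ ((f r).2 : ℕ) ≤ ((f r).1 : ℕ)) ∧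
          (∀ r : Fin m, ((f r.castSucc).1 : ℕ) < ((f r.succ).2 : ℕ)) ∧
          ((f 0).2 : ℕ) = j then
        ∏ r, H ((f r).1 : ℕ) ((f r).2 : ℕ)
      else 0

/-- The H-certificates `λ*_{k,j}(H)`:
`λ*_{N,j}(H) = N·Σ_{m=1}^{N−j} (−1)^{m−1}·Q(N−1,m,j;H)` for `j = 1,…,N−1`, and
`λ*_{k,j}(H) = N·Σ_{ℓ=1}^{N−j} Σ_{m=1}^{N−k} (−1)^{ℓ+m−1}·C(ℓ+m,m)·Q(N−1,ℓ,j;H)·Q(N−1,m,k;H)`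
for `1 ≤ j < k ≤ N−1`. -/
noncomputable def lamStar (N : ℕ) (H : ℕ → ℕ → ℝ) (k j : ℕ) : ℝ :=
  if k = N then
    (N : ℝ) * ∑ m ∈ Finset.Icc 1 (N - j), (-1 : ℝ) ^ (m - 1) * Qinv H (N - 1) m j
  else
    (N : ℝ) * ∑ l ∈ Finset.Icc 1 (N - j), ∑ m ∈ Finset.Icc 1 (N - k),
      (-1 : ℝ) ^ (l + m - 1) * (Nat.choose (l + m) m : ℝ) *
        Qinv H (N - 1) l j * Qinv H (N - 1) m k

theorem sum_Ioc_Qinv_succ (H : ℕ → ℕ → ℝ) (k m i : ℕ) :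
    ∑ j ∈ Ioc i k, Qinv H k (m + 1) j =
      ∑ f : Fin (m + 1) → Fin (k + 1) × Fin (k + 1),
        if (∀ r, 1 ≤ ((f r).2 : ℕ) ∧ ((f r).2 : ℕ) ≤ ((f r).1 : ℕ)) ∧
            (∀ r : Fin m, ((f r.castSucc).1 : ℕ) < ((f r.succ).2 : ℕ)) ∧
            i < ((f 0).2 : ℕ) then
          ∏ r, H ((f r).1 : ℕ) ((f r).2 : ℕ)
        else 0 := by
  simp only [Qinv]
  rw [sum_comm]
  refine sum_congr rfl fun f _ => ?_
  have hle : ((f 0).2 : ℕ) ≤ k := Nat.lt_succ_iff.mp (f 0).2.isLt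
  simp only [← and_assoc]
  simp only [ite_and _ (_ = _), ite_and _ (_ < _)]
  split_ifs <;> simp_all

theorem Pinv_succ_eq_sum_Qinv (H : ℕ → ℕ → ℝ) (k m : ℕ) :
    Pinv H k (m + 1) = ∑ j ∈ Ioc 0 k, Qinv H k (m + 1) j := by
  rw [sum_Ioc_Qinv_succ]
  refine sum_congr rfl fun f _ => if_congr ?_ rfl rfl
  exact ⟨fun h => ⟨h.1, h.2, (h.1 0).1⟩, fun h => ⟨h.1, h.2.1⟩⟩

theorem sum_fin_fin_ite_eq (G : ℕ → ℕ → ℝ) (k j : ℕ) (hj : 1 ≤ j) :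
    (∑ a : Fin (k + 1), ∑ b : Fin (k + 1),
      if (1 ≤ (b : ℕ) ∧ (b : ℕ) ≤ (a : ℕ)) ∧ (b : ℕ) = j then G a b else 0) =
      ∑ i ∈ Icc j k, G i j := by
  have hb (a : Fin (k + 1)) :
      (∑ b : Fin (k + 1),
        if (1 ≤ (b : ℕ) ∧ (b : ℕ) ≤ (a : ℕ)) ∧ (b : ℕ) = j then G a b else 0) =
      if j ≤ (a : ℕ) then G a j else 0 := by
    rw [Fin.sum_univ_eq_sum_range
      (fun b => if (1 ≤ b ∧ b ≤ (a : ℕ)) ∧ b = j then G a b else 0) (k + 1)]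
    have ha := a.isLt
    rw [sum_eq_single j]
    · simp [hj]
    · intro b _ hbj
      simp [hbj]
    · intro hj'
      rw [mem_range] at hj'
      rw [if_neg (by omega)]
  simp only [hb]
  rw [Fin.sum_univ_eq_sum_range (fun a => if j ≤ a then G a j else 0) (k + 1), ← sum_filter]
  refine sum_congr ?_ fun _ _ => rfl
  ext i
  simp only [mem_filter, mem_range, mem_Icc]
  omega

theorem Qinv_one (H : ℕ → ℕ → ℝ) (k j : ℕ) (hj : 1 ≤ j) :
    Qinv H k 1 j = ∑ i ∈ Icc j k, H i j := by
  rw [Qinv, ← (Equiv.funUnique (Fin 1) (Fin (k + 1) × Fin (k + 1))).symm.sum_comp,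
    ← sum_fin_fin_ite_eq H k j hj]
  simp [Fintype.sum_prod_type]

theorem Qinv_succ_succ (H : ℕ → ℕ → ℝ) (k m j : ℕ) (hj : 1 ≤ j) :
    Qinv H k (m + 2) j = ∑ i ∈ Icc j k, H i j * ∑ j' ∈ Ioc i k, Qinv H k (m + 1) j' := by
  simp only [sum_Ioc_Qinv_succ]
  rw [Qinv, ← (Fin.consEquiv fun _ => Fin (k + 1) × Fin (k + 1)).sum_comp]
  rw [← sum_fin_fin_ite_eq (fun i j => H i j * _) k j hj]
  simp only [Fintype.sum_prod_type, Fin.consEquiv_apply]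
  refine sum_congr rfl fun a _ => sum_congr rfl fun b _ => ?_
  simp only [mul_sum, mul_ite, mul_zero]
  split_ifs with h
  · refine sum_congr rfl fun g _ => ?_
    rw [Fin.prod_univ_succ]
    refine if_congr ?_ rfl rfl
    simp only [Fin.forall_fin_succ (n := m + 1), Fin.forall_fin_succ (n := m),
      Fin.castSucc_zero, ← Fin.succ_castSucc, Fin.cons_zero, Fin.cons_succ]
    have h1 := h.1
    have h2 := h.2
    tauto
  · refine sum_eq_zero fun g _ => if_neg ?_
    rintro ⟨h1, -, h3⟩
    exact h ⟨by simpa using h1 0, by simpa using h3⟩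

theorem Qinv_eq_zero (H : ℕ → ℕ → ℝ) (k m j : ℕ) (hj : 1 ≤ j) (hm : k + 1 < m + j) :
    Qinv H k m j = 0 := by
  induction m generalizing j with
  | zero => rfl
  | succ m ih =>
    cases m with
    | zero => rw [Qinv_one H k j hj, Icc_eq_empty (by omega), sum_empty]
    | succ m =>
      rw [Qinv_succ_succ H k m j hj]
      refine sum_eq_zero fun i hi => ?_
      rw [mem_Icc] at hi
      rw [sum_eq_zero, mul_zero]
      intro j' hj'
      rw [mem_Ioc] at hj'
      exact ih j' (by omega) (by omega)

theorem Qinv_top_succ (H : ℕ → ℕ → ℝ) (k m j : ℕ) (hj : 1 ≤ j) (hm : m + 1 + j = k) :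
    Qinv H k (m + 2) j = H j j * Qinv H k (m + 1) (j + 1) := by
  rw [Qinv_succ_succ H k m j hj, sum_eq_single j, sum_eq_single (j + 1)]
  · intro i hi hij
    rw [mem_Ioc] at hi
    exact Qinv_eq_zero H k _ i (by omega) (by omega)
  · intro h
    simp only [mem_Ioc] at h
    omega
  · intro i hi hij
    rw [mem_Icc] at hi
    rw [sum_eq_zero, mul_zero]
    intro j' hj'
    rw [mem_Ioc] at hj'
    exact Qinv_eq_zero H k _ j' (by omega) (by omega)
  · intro h
    simp only [mem_Icc] at h
    omega

theorem Qinv_top_ne_zero (H : ℕ → ℕ → ℝ) (k : ℕ) (h : Pinv H k k ≠ 0) (m j : ℕ) (hj : 1 ≤ j)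
    (hm : m + j = k) : Qinv H k (m + 1) j ≠ 0 := by
  induction j, hj using Nat.le_induction generalizing m with
  | base =>
    subst hm
    rw [Pinv_succ_eq_sum_Qinv, sum_eq_single 1] at h
    · exact h
    · intro i hi hij
      rw [mem_Ioc] at hi
      exact Qinv_eq_zero H _ _ i (by omega) (by omega)
    · simp
  | succ j hj ih =>
    have := ih (m + 1) (by omega)
    rw [Qinv_top_succ H k m j hj (by omega)] at this
    exact right_ne_zero_of_mul this

theorem eq_zero_of_sum_choose_mul_eq_zero (n : ℕ) (d : ℕ → ℝ)
    (h : ∀ r < n, ∑ l ∈ range n, (l.choose r : ℝ) * d l = 0) : ∀ l < n, d l = 0 := by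
  induction n with
  | zero => simp
  | succ n ih =>
    have hn : d n = 0 := by
      have := h n n.lt_succ_self
      rw [sum_range_succ, sum_eq_zero] at this
      · simpa using this
      · intro l hl
        rw [Nat.choose_eq_zero_of_lt (mem_range.mp hl)]
        simp
    intro l hl
    rcases Nat.lt_succ_iff_lt_or_eq.mp hl with hl | rfl
    · refine ih (fun r hr => ?_) l hl
      have := h r (by omega)
      rwa [sum_range_succ, hn, mul_zero, add_zero] at this
    · exact hn

/-- The bilinear form on `ℝⁿ` with Gram matrix `(-1) ^ (l + m) * C(l + m, m)`. -/
noncomputable def pascalForm (n : ℕ) (f g : ℕ → ℝ) : ℝ :=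
  ∑ l ∈ range n, ∑ m ∈ range n, (-1 : ℝ) ^ (l + m) * ((l + m).choose m : ℝ) * f l * g m

theorem choose_add_eq_sum_range (n l m : ℕ) (hm : m < n) :
    (l + m).choose m = ∑ r ∈ range n, l.choose r * m.choose r := by
  rw [Nat.add_choose_eq, Nat.sum_antidiagonal_eq_sum_range_succ_mk]
  rw [← sum_subset (range_subset_range.mpr (Nat.succ_le_of_lt hm))]
  · refine sum_congr rfl fun r hr => ?_
    rw [Nat.choose_symm (Nat.lt_succ_iff.mp (mem_range.mp hr))]
  · intro r _ hr
    rw [mem_range, not_lt] at hr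
    rw [Nat.choose_eq_zero_of_lt (n := m) (by omega), mul_zero]

theorem pascalForm_eq_sum (n : ℕ) (f g : ℕ → ℝ) :
    pascalForm n f g = ∑ r ∈ range n,
      (∑ l ∈ range n, (l.choose r : ℝ) * ((-1) ^ l * f l)) *
        ∑ m ∈ range n, (m.choose r : ℝ) * ((-1) ^ m * g m) := by
  simp only [sum_mul_sum]
  rw [sum_comm, pascalForm]
  refine sum_congr rfl fun l _ => ?_
  rw [sum_comm]
  refine sum_congr rfl fun m hm => ?_
  rw [choose_add_eq_sum_range n l m (mem_range.mp hm)]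
  push_cast
  rw [mul_sum, sum_mul, sum_mul]
  exact sum_congr rfl fun r _ => by ring

theorem eq_zero_of_pascalForm_self (n : ℕ) (f : ℕ → ℝ) (h : pascalForm n f f = 0) :
    ∀ l < n, f l = 0 := by
  rw [pascalForm_eq_sum, sum_eq_zero_iff_of_nonneg fun _ _ => mul_self_nonneg _] at h
  intro l hl
  have := eq_zero_of_sum_choose_mul_eq_zero n (fun l => (-1) ^ l * f l)
    (fun r hr => mul_self_eq_zero.mp (h r (mem_range.mpr hr))) l hl
  simpa using this

theorem pascalForm_comm (n : ℕ) (f g : ℕ → ℝ) : pascalForm n f g = pascalForm n g f := by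
  rw [pascalForm_eq_sum, pascalForm_eq_sum]
  exact sum_congr rfl fun r _ => mul_comm _ _

/-- The linear form `pascalForm n f` evaluated at the `m`-th basis vector. -/
noncomputable def pascalCoord (n : ℕ) (f : ℕ → ℝ) (m : ℕ) : ℝ :=
  ∑ l ∈ range n, (-1 : ℝ) ^ (l + m) * ((l + m).choose m : ℝ) * f l

theorem pascalForm_eq_sum_pascalCoord (n : ℕ) (f g : ℕ → ℝ) :
    pascalForm n f g = ∑ m ∈ range n, pascalCoord n f m * g m := by
  simp only [pascalForm, pascalCoord, sum_mul]
  exact sum_comm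

theorem pascalCoord_sub (n : ℕ) (f g : ℕ → ℝ) (m : ℕ) :
    pascalCoord n (fun l => f l - g l) m = pascalCoord n f m - pascalCoord n g m := by
  simp only [pascalCoord, mul_sub, sum_sub_distrib]

theorem fwdDiff_iter_choose_of_lt (b m : ℕ) (hm : m < b) :
    (fwdDiff 1)^[b] (fun x : ℕ => (x.choose m : ℤ)) = 0 := by
  obtain ⟨k, rfl⟩ := Nat.exists_eq_add_of_lt hm
  rw [show m + k + 1 = (k + 1) + m by ring, Function.iterate_add_apply]
  have := fwdDiff_iter_choose 0 m
  rw [add_zero] at this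
  rw [this, Function.iterate_succ_apply]
  simp only [Nat.choose_zero_right, Nat.cast_one, fwdDiff_const]
  induction k with
  | zero => rfl
  | succ k ih =>
    rw [Function.iterate_succ_apply, fwdDiff_const]
    exact ih (by omega)

theorem sum_neg_one_pow_mul_choose_mul_choose_add (b c m : ℕ) (hm : m < b) :
    ∑ l ∈ range (b + 1), (-1 : ℝ) ^ l * (b.choose l : ℝ) * ((l + c).choose m : ℝ) = 0 := by
  have h := fwdDiff_iter_eq_sum_shift 1 (fun x : ℕ => (x.choose m : ℤ)) b c
  rw [fwdDiff_iter_choose_of_lt b m hm] at h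
  have h' : (0 : ℝ) = ∑ l ∈ range (b + 1),
      (-1 : ℝ) ^ (b - l) * (b.choose l : ℝ) * ((c + l).choose m : ℝ) := by
    have := congrArg (fun z : ℤ => (z : ℝ)) h
    simpa using this
  have hb : ((-1 : ℝ) ^ b) ≠ 0 := by simp
  refine (mul_eq_zero.mp ?_).resolve_left hb
  rw [h', mul_sum]
  refine sum_congr rfl fun l hl => ?_
  have hl : l ≤ b := Nat.lt_succ_iff.mp (mem_range.mp hl)
  obtain ⟨t, rfl⟩ := Nat.exists_eq_add_of_le hl
  rw [Nat.add_sub_cancel_left, add_comm c l, pow_add]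
  have : ((-1 : ℝ) ^ l) * (-1) ^ l = 1 := by rw [← mul_pow]; simp
  linear_combination (-1 : ℝ) ^ t * ((l + t).choose l : ℝ) * ((l + c).choose m : ℝ) * this

/-- The values `Q(n, m, j)` of the Dual-OHM matrix with `N = n + 1`. -/
noncomputable def dualOhmQ (n : ℕ) : ℕ → ℕ → ℝ
  | 0, _ => 0
  | m + 1, j => ((n - j).choose m : ℝ) / (m + 2)

theorem dualOhmQ_eq_zero (n m j : ℕ) (hjn : j ≤ n) (hm : n + 1 < m + j) : dualOhmQ n m j = 0 := by
  cases m with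
  | zero => rfl
  | succ m => rw [dualOhmQ, Nat.choose_eq_zero_of_lt (by omega)]; simp

theorem pascalCoord_dualOhmQ (n m j : ℕ) (hj : 1 ≤ j) (hm : 1 ≤ m) (hmj : m + j ≤ n) :
    pascalCoord (n + 1) (fun l => dualOhmQ n l j) m = 0 := by
  obtain ⟨m, rfl⟩ := Nat.exists_eq_add_of_le' hm
  rw [pascalCoord, sum_range_succ', dualOhmQ, mul_zero, add_zero]
  have hterm (l : ℕ) : (-1 : ℝ) ^ (l + 1 + (m + 1)) * ((l + 1 + (m + 1)).choose (m + 1) : ℝ) *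
      dualOhmQ n (l + 1) j = (-1) ^ m / (m + 1) *
        ((-1 : ℝ) ^ l * ((n - j).choose l : ℝ) * ((l + (m + 2)).choose m : ℝ)) := by
    have h := Nat.choose_succ_right_eq (l + (m + 2)) m
    rw [show l + (m + 2) - m = l + 2 by omega] at h
    have h : ((l + (m + 2)).choose (m + 1) : ℝ) * (m + 1) =
        ((l + (m + 2)).choose m : ℝ) * (l + 2) := by exact_mod_cast h
    rw [dualOhmQ, show l + 1 + (m + 1) = l + (m + 2) by ring, pow_add, pow_add]
    field_simp
    linear_combination ((n - j).choose l : ℝ) * h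
  simp only [hterm]
  rw [← mul_sum, ← sum_subset (range_subset_range.mpr (show n - j + 1 ≤ n by omega)),
    sum_neg_one_pow_mul_choose_mul_choose_add _ _ _ (by omega), mul_zero]
  intro l _ hl
  rw [mem_range, not_lt] at hl
  rw [Nat.choose_eq_zero_of_lt (by omega)]
  simp

theorem sum_range_choose_right (s m : ℕ) :
    ∑ t ∈ range s, t.choose m = s.choose (m + 1) := by
  induction s with
  | zero => rfl
  | succ s ih => rw [sum_range_succ, ih, Nat.choose_succ_succ', add_comm]

theorem sum_Ioc_sub_eq_sum_range (F : ℕ → ℝ) (n i : ℕ) :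
    ∑ j ∈ Ioc i n, F (n - j) = ∑ t ∈ range (n - i), F t := by
  refine sum_nbij' (fun j => n - j) (fun t => n - t) ?_ ?_ ?_ ?_ fun _ _ => rfl
  all_goals
    intro a ha
    simp only [mem_Ioc, mem_range] at *
    omega

theorem sum_Icc_eq_sum_range_sub (F : ℕ → ℝ) (n j : ℕ) (hj : j ≤ n) :
    ∑ i ∈ Icc j n, F i = ∑ t ∈ range (n - j + 1), F (n - t) := by
  refine sum_nbij' (fun j => n - j) (fun t => n - t) ?_ ?_ ?_ ?_ ?_
  all_goals
    intro a ha
    simp only [mem_Icc, mem_range] at *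
  on_goal 5 => rw [Nat.sub_sub_self ha.2]
  all_goals omega

theorem sum_Ioc_dualOhmQ (n m i : ℕ) :
    ∑ j ∈ Ioc i n, dualOhmQ n (m + 1) j = ((n - i).choose (m + 1) : ℝ) / (m + 2) := by
  simp only [dualOhmQ]
  rw [sum_Ioc_sub_eq_sum_range (fun t => (t.choose m : ℝ) / (m + 2)), ← sum_div,
    ← sum_range_choose_right, Nat.cast_sum]

theorem choose_div_succ_succ (n m : ℕ) :
    (n.choose (m + 1) : ℝ) / (m + 2) = 1 / ((n : ℝ) + 1) * ((n + 1).choose (m + 2) : ℝ) := by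
  have h : ((n : ℝ) + 1) * (n.choose (m + 1) : ℝ) = ((n + 1).choose (m + 2) : ℝ) * (m + 1 + 1) := by
    exact_mod_cast Nat.add_one_mul_choose_eq n (m + 1)
  field_simp
  linear_combination h

theorem eq_dualOhmQ_of_orthogonal (n : ℕ) (q : ℕ → ℕ → ℝ) (h0 : ∀ j, q 0 j = 0)
    (hz : ∀ m j, 1 ≤ j → n + 1 < m + j → q m j = 0)
    (htop : ∀ m j, 1 ≤ j → m + j = n → q (m + 1) j ≠ 0)
    (hsum : ∀ m < n, ∑ j ∈ Ioc 0 n, q (m + 1) j = 1 / ((n : ℝ) + 1) * ((n + 1).choose (m + 2) : ℝ))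
    (horth : ∀ j k, 1 ≤ j → j < k → k ≤ n →
      pascalForm (n + 1) (fun l => q l j) (fun l => q l k) = 0)
    (m j : ℕ) (hj : 1 ≤ j) (hjn : j ≤ n) : q m j = dualOhmQ n m j := by
  have hcoord (m : ℕ) : 1 ≤ m → ∀ j, 1 ≤ j → m + j ≤ n →
      pascalCoord (n + 1) (fun l => q l j) m = 0 := by
    induction m using Nat.strong_induction_on with
    | _ m ih =>
      intro hm j hj hmj
      have h := horth j (n + 1 - m) hj (by omega) (by omega)
      rw [pascalForm_eq_sum_pascalCoord, sum_eq_single m] at h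
      · refine (mul_eq_zero.mp h).resolve_right ?_
        obtain ⟨m, rfl⟩ := Nat.exists_eq_add_of_le' hm
        exact htop m _ (by omega) (by omega)
      · intro l _ hlm
        rcases Nat.eq_zero_or_pos l with rfl | hl
        · rw [h0, mul_zero]
        · rcases Nat.lt_or_gt_of_ne hlm with hlm | hlm
          · rw [ih l hlm hl j hj (by omega), zero_mul]
          · rw [hz l _ (by omega) (by omega), mul_zero]
      · intro h
        exact absurd (mem_range.mpr (by omega)) h
  let d : ℕ → ℕ → ℝ := fun j l => q l j - dualOhmQ n l j
  have hd0 (j : ℕ) : d j 0 = 0 := by simp [d, h0, dualOhmQ]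
  have hdz (l j : ℕ) (hj : 1 ≤ j) (hjn : j ≤ n) (hl : n + 1 < l + j) : d j l = 0 := by
    simp [d, hz l j hj hl, dualOhmQ_eq_zero n l j hjn hl]
  have hdcoord (m j : ℕ) (hm : 1 ≤ m) (hj : 1 ≤ j) (hmj : m + j ≤ n) :
      pascalCoord (n + 1) (d j) m = 0 := by
    simp only [d]
    rw [pascalCoord_sub, hcoord m hm j hj hmj, pascalCoord_dualOhmQ n m j hj hm hmj, sub_zero]
  have hdlt (i j : ℕ) (hi : 1 ≤ i) (hij : i < j) (hjn : j ≤ n) :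
      pascalForm (n + 1) (d i) (d j) = 0 := by
    rw [pascalForm_eq_sum_pascalCoord]
    refine sum_eq_zero fun l _ => ?_
    rcases Nat.eq_zero_or_pos l with rfl | hl
    · rw [hd0, mul_zero]
    · rcases le_or_gt (l + i) n with h | h
      · rw [hdcoord l i hl hi h, zero_mul]
      · rw [hdz l j (by omega) hjn (by omega), mul_zero]
  have hdsum (l : ℕ) (hl : l < n + 1) : ∑ i ∈ Ioc 0 n, d i l = 0 := by
    cases l with
    | zero => exact sum_eq_zero fun i _ => hd0 i
    | succ l =>
      simp only [d]
      rw [sum_sub_distrib, hsum l (by omega), sum_Ioc_dualOhmQ, Nat.sub_zero,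
        choose_div_succ_succ, sub_self]
  have hself : pascalForm (n + 1) (d j) (d j) = 0 := by
    have h : ∑ i ∈ Ioc 0 n, pascalForm (n + 1) (d j) (d i) = 0 := by
      simp only [pascalForm_eq_sum_pascalCoord]
      rw [sum_comm]
      refine sum_eq_zero fun l hl => ?_
      rw [← mul_sum, hdsum l (mem_range.mp hl), mul_zero]
    rwa [sum_eq_single j] at h
    · intro i hi hij
      rw [mem_Ioc] at hi
      rcases Nat.lt_or_gt_of_ne hij with hij | hij
      · rw [pascalForm_comm]
        exact hdlt i j hi.1 hij hjn
      · exact hdlt j i hj hij hi.2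
    · intro h
      exact absurd (mem_Ioc.mpr ⟨hj, hjn⟩) h
  rcases lt_or_ge m (n + 1) with hm | hm
  · exact sub_eq_zero.mp (eq_zero_of_pascalForm_self (n + 1) (d j) hself m hm)
  · exact sub_eq_zero.mp (hdz m j hj hjn (by omega))

/-- The entry in column `n - s` and row `n - l` of the Dual-OHM matrix with `N = n + 1`. -/
noncomputable def dualOhmColumn (s l : ℕ) : ℝ :=
  if l = s then ((s : ℝ) + 1) / (s + 2) else -(((l : ℝ) + 1) / ((s + 1) * (s + 2)))

theorem sum_choose_mul_dualOhmColumn (s m : ℕ) :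
    ∑ l ∈ range (s + 1), (l.choose m : ℝ) * dualOhmColumn s l =
      ((m : ℝ) + 1) / (m + 2) * (s.choose m : ℝ) := by
  have h1 : ∑ l ∈ range s, (l.choose m : ℝ) * dualOhmColumn s l =
      -((m + 1) * ((s + 1).choose (m + 2) : ℝ) / ((s + 1) * (s + 2))) := by
    have hterm : ∀ l ∈ range s, (l.choose m : ℝ) * dualOhmColumn s l =
        ((l + 1).choose (m + 1) : ℝ) * -((m + 1) / ((s + 1) * (s + 2))) := by
      intro l hl
      have h : ((l : ℝ) + 1) * (l.choose m : ℝ) = ((l + 1).choose (m + 1) : ℝ) * (m + 1) := by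
        exact_mod_cast Nat.add_one_mul_choose_eq l m
      rw [dualOhmColumn, if_neg (mem_range.mp hl).ne]
      field_simp
      linear_combination -h
    rw [sum_congr rfl hterm, ← sum_mul]
    have h : ∑ l ∈ range s, ((l + 1).choose (m + 1) : ℝ) = ((s + 1).choose (m + 2) : ℝ) := by
      rw [← sum_range_choose_right, sum_range_succ', Nat.choose_zero_succ, add_zero, Nat.cast_sum]
    rw [h]
    ring
  have h2 : ((s : ℝ) + 1) * (s.choose (m + 1) : ℝ) = ((s + 1).choose (m + 2) : ℝ) * (m + 2) := by
    exact_mod_cast Nat.add_one_mul_choose_eq s (m + 1)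
  have h3 : (s.choose (m + 1) : ℝ) * (m + 1) = (s.choose m : ℝ) * (s - m) := by
    rcases le_or_gt m s with h | h
    · rw [← Nat.cast_sub h]
      exact_mod_cast Nat.choose_succ_right_eq s m
    · rw [Nat.choose_eq_zero_of_lt h, Nat.choose_eq_zero_of_lt (by omega)]
      simp
  have h4 : ((s + 1).choose (m + 2) : ℝ) = (s + 1) * (s.choose (m + 1) : ℝ) / (m + 2) := by
    rw [h2]
    field_simp
  rw [sum_range_succ, h1, h4, dualOhmColumn, if_pos rfl]
  field_simp
  linear_combination -h3

theorem Qinv_succ_eq_sum_choose (H : ℕ → ℕ → ℝ) (n : ℕ)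
    (hQ : ∀ m j, 1 ≤ j → j ≤ n → Qinv H n m j = dualOhmQ n m j) (m j : ℕ) (hj : 1 ≤ j)
    (hjn : j ≤ n) :
    Qinv H n (m + 1) j =
      ∑ l ∈ range (n - j + 1), (l.choose m : ℝ) * H (n - l) j / (m + 1) := by
  cases m with
  | zero =>
    rw [Qinv_one H n j hj, sum_Icc_eq_sum_range_sub _ n j hjn]
    simp
  | succ m =>
    rw [Qinv_succ_succ H n m j hj, sum_Icc_eq_sum_range_sub _ n j hjn]
    refine sum_congr rfl fun l hl => ?_
    have hl : l ≤ n := by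
      rw [mem_range] at hl
      omega
    have : ∑ i ∈ Ioc (n - l) n, Qinv H n (m + 1) i =
        ∑ i ∈ Ioc (n - l) n, dualOhmQ n (m + 1) i :=
      sum_congr rfl fun i hi => by
        rw [mem_Ioc] at hi
        exact hQ _ i (by omega) hi.2
    rw [this, sum_Ioc_dualOhmQ, Nat.sub_sub_self hl]
    push_cast
    ring

theorem eq_dualOhmColumn_of_Qinv (H : ℕ → ℕ → ℝ) (n : ℕ)
    (hQ : ∀ m j, 1 ≤ j → j ≤ n → Qinv H n m j = dualOhmQ n m j) (l j : ℕ) (hj : 1 ≤ j)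
    (hl : l + j ≤ n) : H (n - l) j = dualOhmColumn (n - j) l := by
  refine sub_eq_zero.mp (eq_zero_of_sum_choose_mul_eq_zero (n - j + 1)
    (fun l => H (n - l) j - dualOhmColumn (n - j) l) (fun m _ => ?_) l (by omega))
  have h := Qinv_succ_eq_sum_choose H n hQ m j hj (by omega)
  rw [hQ _ j hj (by omega), dualOhmQ, ← sum_div] at h
  simp only [mul_sub, sum_sub_distrib]
  rw [sum_choose_mul_dualOhmColumn]
  field_simp at h ⊢
  linear_combination -h

theorem lamStar_eq_pascalForm (H : ℕ → ℕ → ℝ) (n j k : ℕ) (hj : 1 ≤ j) (hjk : j < k)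
    (hk : k ≤ n) :
    lamStar (n + 1) H k j =
      -((n : ℝ) + 1) * pascalForm (n + 1) (fun l => Qinv H n l j) (fun l => Qinv H n l k) := by
  have hsub (i : ℕ) (hi : 1 ≤ i) : Icc 1 (n + 1 - i) ⊆ range (n + 1) := fun l hl => by
    rw [mem_Icc] at hl
    rw [mem_range]
    omega
  have hzero (i l : ℕ) (hi : 1 ≤ i) (hl : l ∉ Icc 1 (n + 1 - i)) : Qinv H n l i = 0 := by
    rcases Nat.eq_zero_or_pos l with rfl | hl0
    · rfl
    · rw [mem_Icc, not_and, not_le] at hl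
      exact Qinv_eq_zero H n l i hi (by have := hl hl0; omega)
  rw [lamStar, if_neg (by omega), Nat.add_sub_cancel, pascalForm,
    ← sum_subset (hsub j hj) fun l _ hl => sum_eq_zero fun m _ => by
      rw [hzero j l hj hl, mul_zero, zero_mul], neg_mul, ← mul_neg, ← sum_neg_distrib]
  push_cast
  congr 1
  refine sum_congr rfl fun l hl => ?_
  rw [← sum_subset (hsub k (by omega)) fun m _ hm => by
      rw [hzero k m (by omega) hm, mul_zero], ← sum_neg_distrib]
  refine sum_congr rfl fun m _ => ?_
  obtain ⟨l, rfl⟩ := Nat.exists_eq_add_of_le' (mem_Icc.mp hl).1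
  rw [show l + 1 + m - 1 = l + m by omega, show l + 1 + m = l + m + 1 by ring, pow_succ]
  ring

/-- **Dual-OHM is the unique optimal H-matrix with the bottom-sparsity pattern
(Props 8.4, 8.5).** If `H` satisfies H-invariance and `λ*_{k,j}(H) = 0` for all
`j = 1,…,N−2` and `k = j+1,…,N−1`, then `Q(N−1,k,j;H) = (1/(k+1))·C(N−j−1,k−1)` for all
admissible `j,k`, and `H` is the H-matrix of Dual-OHM: `h_{k,k} = (N−k)/(N−k+1)` and
`h_{k,j} = −(N−k)/((N−j)(N−j+1))` for `j < k`. -/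
theorem dual_ohm_from_bottom_sparsity (N : ℕ) (hN : 2 ≤ N) (H : ℕ → ℕ → ℝ)
    (hinv : ∀ m, 1 ≤ m → m ≤ N - 1 →
      Pinv H (N - 1) m = 1 / (N : ℝ) * (Nat.choose N (m + 1) : ℝ))
    (hsparse : ∀ j k, 1 ≤ j → j ≤ N - 2 → j + 1 ≤ k → k ≤ N - 1 → lamStar N H k j = 0) :
    (∀ j k, 1 ≤ j → j ≤ N - 1 → 1 ≤ k → k ≤ N - j →
      Qinv H (N - 1) k j
        = 1 / ((k : ℝ) + 1) * (Nat.choose (N - j - 1) (k - 1) : ℝ)) ∧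
    (∀ k, 1 ≤ k → k ≤ N - 1 →
      H k k = ((N : ℝ) - (k : ℝ)) / ((N : ℝ) - (k : ℝ) + 1)) ∧
    (∀ k j, 1 ≤ j → j < k → k ≤ N - 1 →
      H k j = -(((N : ℝ) - (k : ℝ)) / (((N : ℝ) - (j : ℝ)) * ((N : ℝ) - (j : ℝ) + 1)))) := by
  obtain ⟨n, rfl⟩ := Nat.exists_eq_add_of_le' (show 1 ≤ N by omega)
  rw [Nat.add_sub_cancel] at hinv hsparse ⊢
  have hPn : Pinv H n n ≠ 0 := by
    rw [hinv n (by omega) le_rfl, Nat.choose_self]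
    positivity
  have hQ (m j : ℕ) (hj : 1 ≤ j) (hjn : j ≤ n) : Qinv H n m j = dualOhmQ n m j := by
    refine eq_dualOhmQ_of_orthogonal n (Qinv H n) (fun _ => rfl) (fun m j => Qinv_eq_zero H n m j)
      (Qinv_top_ne_zero H n hPn) (fun m hm => ?_) (fun j k hj hjk hk => ?_) m j hj hjn
    · rw [← Pinv_succ_eq_sum_Qinv, hinv (m + 1) (by omega) (by omega)]
      push_cast
      rfl
    · have h := hsparse j k hj (by omega) hjk hk
      rw [lamStar_eq_pascalForm H n j k hj hjk hk] at h
      exact (mul_eq_zero.mp h).resolve_left (neg_ne_zero.mpr (by positivity))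
  refine ⟨fun j k hj hjn hk _ => ?_, fun k hk hkn => ?_, fun k j hj hjk hkn => ?_⟩
  · obtain ⟨k, rfl⟩ := Nat.exists_eq_add_of_le' hk
    rw [hQ _ j hj hjn, dualOhmQ, Nat.add_sub_cancel, show n + 1 - j - 1 = n - j by omega]
    push_cast
    ring
  · have h := eq_dualOhmColumn_of_Qinv H n hQ (n - k) k hk (by omega)
    rw [Nat.sub_sub_self hkn, dualOhmColumn, if_pos rfl, Nat.cast_sub hkn] at h
    rw [h]
    push_cast
    ring
  · have h := eq_dualOhmColumn_of_Qinv H n hQ (n - k) j hj (by omega)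
    rw [Nat.sub_sub_self hkn, dualOhmColumn, if_neg (by omega), Nat.cast_sub hkn,
      Nat.cast_sub (hjk.le.trans hkn)] at h
    rw [h]
    push_cast
    ring
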